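/- Let K be an H-operator-valued kernel on X which is Γ-invariant and partially positive semidefinite with respect to the partition {X_s}_{s∈S}. Then there exists a minimal generalised Γ-invariant Hilbert space linearisation (𝒦, D, V, Ψ) of K. Moreover, it is unique modulo unitary equivalence in the following sense: whenever (𝒦′, D′, V′, Ψ′) is another minimal generalised Γ-invariant Hilbert space linearisation of K with D′_s = span{V′_x H_x : x ∈ X_s} for all s ∈ S, there exists a family of unitary operators {U_s}_{s∈S} such that (a) U_s : 𝒦_s → 𝒦′_s and U_s D_s ⊆ D′_s for all s ∈ S, (b) U_{c(α)} Ψ(α)|_{D_{d(α)}} = Ψ′(α) U_{d(α)}|_{D_{d(α)}} for all α ∈ Γ, and (c) U_{a(x)} V_x = V′_x for all x ∈ X. -/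

import Mathlib

open scoped InnerProductSpace

noncomputable section

universe u uΓ uS v vO w

/-- A `*`-semigroupoid: partially defined multiplication (the product `mul α β`
is subject to the axioms only when `d α = c β`) together with an involution. -/
structure StarSgd (Γ : Type uΓ) (S : Type uS) where
  d : Γ → S
  c : Γ → S
  mul : Γ → Γ → Γ
  star : Γ → Γ
  d_mul : ∀ {α β : Γ}, d α = c β → d (mul α β) = d β
  c_mul : ∀ {α β : Γ}, d α = c β → c (mul α β) = c α
  mul_assoc : ∀ {α β γ : Γ}, d α = c β → d β = c γ →
    mul α (mul β γ) = mul (mul α β) γ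
  d_star : ∀ α, d (star α) = c α
  c_star : ∀ α, c (star α) = d α
  star_star : ∀ α, star (star α) = α
  star_mul : ∀ {α β : Γ}, d α = c β → star (mul α β) = mul (star β) (star α)

/-- A left action of a semigroupoid on a set `X`, with surjective anchor `a`;
`act α x` is subject to the axioms only when `d α = a x`. -/
structure SgdAction (Γ : Type uΓ) (S : Type uS) (X : Type v) (G : StarSgd Γ S) where
  a : X → S
  a_surj : Function.Surjective a
  act : Γ → X → X
  a_act : ∀ {α : Γ} {x : X}, G.d α = a x → a (act α x) = G.c α
  act_mul : ∀ {α β : Γ} {x : X}, G.d β = a x → G.d α = G.c β →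
    act (G.mul α β) x = act α (act β x)

variable {𝕜 : Type u} [RCLike 𝕜] {Γ : Type uΓ} {S : Type uS} {X : Type v}
  {O : Type vO} {E : O → Type w}
  [∀ o, NormedAddCommGroup (E o)] [∀ o, InnerProductSpace 𝕜 (E o)]
  [∀ o, CompleteSpace (E o)]

/-- Transport along an equality of indices: since the Hilbert bundle over `X`
is given as a pullback `x ↦ E (p x)`, equal indices give literally the same
Hilbert space, and the transport is a linear isometry. -/
def castE (𝕜 : Type u) [RCLike 𝕜] {O : Type vO} (E : O → Type w)
    [∀ o, NormedAddCommGroup (E o)] [∀ o, InnerProductSpace 𝕜 (E o)]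
    {o o' : O} (h : o = o') : E o ≃ₗᵢ[𝕜] E o' := by
  subst h; exact LinearIsometryEquiv.refl 𝕜 (E o)

variable {G : StarSgd Γ S} (A : SgdAction Γ S X G) (p : X → O)

/-- `K` is partially Hermitian with respect to the partition of `X` into the
fibres of the anchor map. -/
def PartHermitian (K : ∀ y x : X, E (p x) →L[𝕜] E (p y)) : Prop :=
  ∀ x y : X, A.a x = A.a y → ContinuousLinearMap.adjoint (K x y) = K y x

/-- `K` is partially positive semidefinite with respect to the partition of
`X` into the fibres of the anchor map. -/
def PartPSD (K : ∀ y x : X, E (p x) →L[𝕜] E (p y)) : Prop :=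
  PartHermitian A p K ∧
  ∀ (s : S) (n : ℕ) (x : Fin n → X), (∀ i, A.a (x i) = s) →
    ∀ h : ∀ i, E (p (x i)),
      0 ≤ RCLike.re (∑ i, ∑ j, ⟪K (x j) (x i) (h i), h j⟫_𝕜)

variable (hp : ∀ {α : Γ} {x : X}, G.d α = A.a x → p (A.act α x) = p x)

/-- `K` is `Γ`-invariant: `K(α·x, y) = K(x, α*·y)`, expressed using the
transport isometries coming from the constancy of the bundle on orbits. -/
def GammaInvariant (K : ∀ y x : X, E (p x) →L[𝕜] E (p y)) : Prop :=
  ∀ (α : Γ) (x y : X) (hx : G.d α = A.a x) (hy : G.c α = A.a y) (k : E (p y)),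
    castE 𝕜 E (hp hx) (K (A.act α x) y k) =
      K x (A.act (G.star α) y)
        ((castE 𝕜 E (hp ((G.d_star α).trans hy))).symm k)

/-- `K` is of bounded shift type: for every `α` there is `M_α ≥ 0` dominating
the shifted quadratic forms by the original ones (stated via finite families of
points in the fibre `X_{d(α)}`). -/
def BoundedShiftType (K : ∀ y x : X, E (p x) →L[𝕜] E (p y)) : Prop :=
  ∀ α : Γ, ∃ M : ℝ, 0 ≤ M ∧
    ∀ (n : ℕ) (z : Fin n → X) (hz : ∀ i, G.d α = A.a (z i))
      (g : ∀ i, E (p (z i))),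
      RCLike.re (∑ i, ∑ j, ⟪K (A.act α (z j)) (A.act α (z i))
          ((castE 𝕜 E (hp (hz i))).symm (g i)),
          (castE 𝕜 E (hp (hz j))).symm (g j)⟫_𝕜) ≤
        M * RCLike.re (∑ i, ∑ j, ⟪K (z j) (z i) (g i), g j⟫_𝕜)

universe w'

/-- A bundled Hilbert space over `𝕜`. -/
structure HSp (𝕜 : Type u) [RCLike 𝕜] : Type (max u (w' + 1)) where
  carrier : Type w'
  [ng : NormedAddCommGroup carrier]
  [ip : InnerProductSpace 𝕜 carrier]
  [cs : CompleteSpace carrier]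

attribute [instance] HSp.ng HSp.ip HSp.cs

/-- Transport between the members of a bundle of Hilbert spaces along an
equality of indices. -/
def castH (𝕜 : Type u) [RCLike 𝕜] {S : Type uS} (𝒦 : S → HSp.{u, w'} 𝕜)
    {s t : S} (h : s = t) : (𝒦 s).carrier ≃ₗᵢ[𝕜] (𝒦 t).carrier := by
  subst h; exact LinearIsometryEquiv.refl 𝕜 (𝒦 s).carrier

/-- Transport between the members of a bundle of subspaces along an equality
of indices. -/
def castSub {𝕜 : Type u} [RCLike 𝕜] {S : Type uS} {𝒦 : S → HSp.{u, w'} 𝕜}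
    (D : ∀ s : S, Submodule 𝕜 (𝒦 s).carrier) {s t : S} (h : s = t) :
    ↥(D s) ≃ₗ[𝕜] ↥(D t) := by
  subst h; exact LinearEquiv.refl 𝕜 ↥(D s)

/-- A generalised `Γ`-invariant Hilbert space linearisation of the kernel `K`:
a bundle of Hilbert spaces `𝒦_s` with dense subspaces `D_s`, bounded operators
`V_x : H_x → 𝒦_{a(x)}` with ranges in `D_{a(x)}` and `K(x,y) = V_x* V_y` on
each fibre, and a generalised `*`-representation `Ψ` by (possibly unbounded)
operators `Ψ(α) : D_{d(α)} → D_{c(α)}` such that `Ψ(α) V_x = V_{α·x}`. -/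
structure GenInvLin (𝕜 : Type u) [RCLike 𝕜] {Γ : Type uΓ} {S : Type uS}
    {X : Type v} {O : Type vO} (E : O → Type w)
    [∀ o, NormedAddCommGroup (E o)] [∀ o, InnerProductSpace 𝕜 (E o)]
    [∀ o, CompleteSpace (E o)]
    {G : StarSgd Γ S} (A : SgdAction Γ S X G) (p : X → O)
    (hp : ∀ {α : Γ} {x : X}, G.d α = A.a x → p (A.act α x) = p x)
    (K : ∀ y x : X, E (p x) →L[𝕜] E (p y)) :
    Type (max u uΓ uS v w (w' + 1)) where
  Ksp : S → HSp.{u, w'} 𝕜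
  D : ∀ s : S, Submodule 𝕜 (Ksp s).carrier
  dense_D : ∀ s : S, Dense (D s : Set (Ksp s).carrier)
  V : ∀ x : X, E (p x) →L[𝕜] (Ksp (A.a x)).carrier
  mem_D : ∀ (x : X) (h : E (p x)), V x h ∈ D (A.a x)
  lin : ∀ (x y : X) (hxy : A.a y = A.a x) (k : E (p y)) (h : E (p x)),
    ⟪(K x y) k, h⟫_𝕜 = ⟪castH 𝕜 Ksp hxy (V y k), V x h⟫_𝕜
  Ψ : ∀ α : Γ, ↥(D (G.d α)) →ₗ[𝕜] ↥(D (G.c α))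
  Ψ_mul : ∀ (α β : Γ) (hc : G.d α = G.c β) (f : ↥(D (G.d β))),
    Ψ (G.mul α β) (castSub D (G.d_mul hc).symm f) =
      castSub D (G.c_mul hc).symm (Ψ α (castSub D hc.symm (Ψ β f)))
  Ψ_adj : ∀ (α : Γ) (f : ↥(D (G.d α))) (g : ↥(D (G.c α))),
    ⟪((Ψ α f) : (Ksp (G.c α)).carrier), (g : (Ksp (G.c α)).carrier)⟫_𝕜 =
      ⟪(f : (Ksp (G.d α)).carrier),
        ((castSub D (G.c_star α)
          (Ψ (G.star α) (castSub D (G.d_star α).symm g))) :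
            (Ksp (G.d α)).carrier)⟫_𝕜
  Ψ_shift : ∀ (α : Γ) (x : X) (hx : G.d α = A.a x) (h : E (p x)),
    ((Ψ α (castSub D hx.symm ⟨V x h, mem_D x h⟩)) : (Ksp (G.c α)).carrier) =
      castH 𝕜 Ksp (A.a_act hx) (V (A.act α x) ((castE 𝕜 E (hp hx)).symm h))

/-- Minimality of a generalised `Γ`-invariant linearisation: each `𝒦_s` is the
closed linear span of the ranges `V_x H_x`, `x ∈ X_s`. -/
def GenInvLin.Minimal {𝕜 : Type u} [RCLike 𝕜] {Γ : Type uΓ} {S : Type uS}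
    {X : Type v} {O : Type vO} {E : O → Type w}
    [∀ o, NormedAddCommGroup (E o)] [∀ o, InnerProductSpace 𝕜 (E o)]
    [∀ o, CompleteSpace (E o)]
    {G : StarSgd Γ S} {A : SgdAction Γ S X G} {p : X → O}
    {hp : ∀ {α : Γ} {x : X}, G.d α = A.a x → p (A.act α x) = p x}
    {K : ∀ y x : X, E (p x) →L[𝕜] E (p y)}
    (L : GenInvLin.{u, uΓ, uS, v, vO, w, w'} 𝕜 E A p hp K) : Prop :=
  ∀ s : S, Dense (↑(Submodule.span 𝕜 (⋃ x : {x : X // A.a x = s},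
    Set.range fun h : E (p x.val) => castH 𝕜 L.Ksp x.2 (L.V x.val h))) :
      Set (L.Ksp s).carrier)

section Kolmogorov

open DFinsupp

universe uk uI uF uH uH'

variable {k : Type uk} [RCLike k] {I : Type uI} {F : I → Type uF}
  [∀ i, NormedAddCommGroup (F i)] [∀ i, InnerProductSpace k (F i)]

/-- The linear map on finitely supported families induced by a family of linear maps. -/
def famSum {M : Type uH} [AddCommGroup M] [Module k M] (V : ∀ i, F i →ₗ[k] M) :
    (Π₀ i, F i) →ₗ[k] M := by
  classical exact DFinsupp.lsum ℕ V

@[simp]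
theorem famSum_single [DecidableEq I] {M : Type uH} [AddCommGroup M] [Module k M]
    (V : ∀ i, F i →ₗ[k] M) (i : I) (h : F i) : famSum V (single i h) = V i h := by
  unfold famSum
  convert DFinsupp.lsum_single ℕ V i h

theorem famSum_eq_sum {M : Type uH} [AddCommGroup M] [Module k M]
    [DecidableEq I] [∀ i (x : F i), Decidable (x ≠ 0)]
    (V : ∀ i, F i →ₗ[k] M) (f : Π₀ i, F i) :
    famSum V f = ∑ i ∈ f.support, V i (f i) := by
  conv_lhs => rw [← DFinsupp.sum_single (f := f)]
  simp [DFinsupp.sum, map_sum]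

theorem range_famSum {M : Type uH} [AddCommGroup M] [Module k M] (V : ∀ i, F i →ₗ[k] M) :
    LinearMap.range (famSum V) = Submodule.span k (⋃ i, Set.range (V i)) := by
  classical
  apply le_antisymm
  · rintro _ ⟨f, rfl⟩
    rw [famSum_eq_sum]
    exact Submodule.sum_mem _ fun i _ =>
      Submodule.subset_span (Set.mem_iUnion.2 ⟨i, f i, rfl⟩)
  · rw [Submodule.span_le]
    intro m hm
    obtain ⟨i, h, rfl⟩ := Set.mem_iUnion.1 hm
    exact ⟨single i h, famSum_single V i h⟩

/-- The (degenerate) sesquilinear form on finitely supported families given by a kernel. -/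
def kernelForm (K : ∀ i j : I, F j →L[k] F i) (f g : Π₀ i, F i) : k :=
  famSum (fun j => (innerₛₗ k (famSum (fun i => (K j i).toLinearMap) f) : F j →ₗ[k] k)) g

theorem kernelForm_eq_sum [DecidableEq I] [∀ i (x : F i), Decidable (x ≠ 0)]
    (K : ∀ i j : I, F j →L[k] F i) (f g : Π₀ i, F i) :
    kernelForm K f g = ∑ i ∈ f.support, ∑ j ∈ g.support, ⟪K j i (f i), g j⟫_k := by
  rw [Finset.sum_comm]
  simp [kernelForm, famSum_eq_sum]

theorem kernelForm_single [DecidableEq I] (K : ∀ i j : I, F j →L[k] F i) (i j : I) (a : F i)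
    (b : F j) : kernelForm K (single i a) (single j b) = ⟪K j i a, b⟫_k := by
  simp [kernelForm]

/-- A positive semidefinite kernel makes finitely supported families into a pre-inner product
space. -/
@[reducible]
def kernelCore (K : ∀ i j : I, F j →L[k] F i)
    (hsymm : ∀ i j a b, ⟪K j i a, b⟫_k = ⟪a, K i j b⟫_k)
    (hpos : ∀ (n : ℕ) (x : Fin n → I) (h : ∀ i, F (x i)),
      0 ≤ RCLike.re (∑ i, ∑ j, ⟪K (x j) (x i) (h i), h j⟫_k)) :
    PreInnerProductSpace.Core k (Π₀ i, F i) where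
  inner f g := kernelForm K f g
  conj_inner_symm f g := by
    classical
    simp only [kernelForm_eq_sum, map_sum, inner_conj_symm]
    rw [Finset.sum_comm]
    simp only [hsymm]
  re_inner_nonneg f := by
    classical
    have e := f.support.equivFin.symm
    have := hpos f.support.card (fun n => (e n).1) (fun n => f (e n).1)
    simp only [kernelForm_eq_sum]
    convert this using 2
    rw [← Finset.sum_coe_sort, ← e.sum_comp]
    refine Finset.sum_congr rfl fun n _ => ?_
    rw [← Finset.sum_coe_sort, ← e.sum_comp]
  add_left f g h := by
    classical
    simp [kernelForm, famSum_eq_sum _ h, Finset.sum_add_distrib]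
  smul_left f g r := by
    classical
    simp [kernelForm, famSum_eq_sum _ g, Finset.mul_sum]

/-- Kolmogorov decomposition of a positive semidefinite operator-valued kernel. -/
theorem exists_kolmogorov (K : ∀ i j : I, F j →L[k] F i)
    (hsymm : ∀ i j a b, ⟪K j i a, b⟫_k = ⟪a, K i j b⟫_k)
    (hpos : ∀ (n : ℕ) (x : Fin n → I) (h : ∀ i, F (x i)),
      0 ≤ RCLike.re (∑ i, ∑ j, ⟪K (x j) (x i) (h i), h j⟫_k)) :
    ∃ (H : HSp.{uk, max uI uF} k) (V : ∀ i, F i →L[k] H.carrier),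
      (∀ i j a b, ⟪V i a, V j b⟫_k = ⟪K j i a, b⟫_k) ∧
      Dense (Submodule.span k (⋃ i, Set.range (V i)) : Set H.carrier) := by
  classical
  let core := kernelCore K hsymm hpos
  let : SeminormedAddCommGroup (Π₀ i, F i) :=
    InnerProductSpace.Core.toSeminormedAddCommGroup (𝕜 := k)
  let : InnerProductSpace k (Π₀ i, F i) := .ofCore core
  let ι : (Π₀ i, F i) →L[k] UniformSpace.Completion (Π₀ i, F i) :=
    UniformSpace.Completion.toComplL
  let V₀ : ∀ i, F i →ₗ[k] UniformSpace.Completion (Π₀ i, F i) :=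
    fun i => ι.toLinearMap ∘ₗ DFinsupp.lsingle i
  have hV₀ : ∀ i j a b, ⟪V₀ i a, V₀ j b⟫_k = ⟪K j i a, b⟫_k := fun i j a b =>
    (UniformSpace.Completion.inner_coe _ _).trans (kernelForm_single K i j a b)
  have hbound : ∀ i a, ‖V₀ i a‖ ≤ √‖K i i‖ * ‖a‖ := fun i a => by
    refine (sq_le_sq₀ (norm_nonneg _) (by positivity)).1 ?_
    rw [← inner_self_eq_norm_sq (𝕜 := k), hV₀, mul_pow, Real.sq_sqrt (norm_nonneg _)]
    calc RCLike.re ⟪K i i a, a⟫_k ≤ ‖⟪K i i a, a⟫_k‖ := RCLike.re_le_norm _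
      _ ≤ ‖K i i a‖ * ‖a‖ := norm_inner_le_norm _ _
      _ ≤ ‖K i i‖ * ‖a‖ * ‖a‖ := by gcongr; exact (K i i).le_opNorm a
      _ = ‖K i i‖ * ‖a‖ ^ 2 := by ring
  refine ⟨⟨UniformSpace.Completion (Π₀ i, F i)⟩,
    fun i => (V₀ i).mkContinuous _ (hbound i), hV₀, ?_⟩
  have hsum : famSum V₀ = ι.toLinearMap := DFinsupp.lhom_ext fun i a => famSum_single V₀ i a
  have hrange := range_famSum V₀
  rw [hsum] at hrange
  have hd : Dense (LinearMap.range ι.toLinearMap :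
      Set (UniformSpace.Completion (Π₀ i, F i))) :=
    UniformSpace.Completion.denseRange_coe
  rw [hrange] at hd
  exact hd

variable {H : Type uH} [NormedAddCommGroup H] [InnerProductSpace k H]
  {H' : Type uH'} [NormedAddCommGroup H'] [InnerProductSpace k H']

theorem inner_famSum_left (V : ∀ i, F i →ₗ[k] H) (f : Π₀ i, F i) (y : H) [DecidableEq I]
    [∀ i (x : F i), Decidable (x ≠ 0)] :
    ⟪famSum V f, y⟫_k = ∑ i ∈ f.support, ⟪V i (f i), y⟫_k := by
  rw [famSum_eq_sum, sum_inner]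

/-- Two families of maps with the same Gram kernel and total ranges are unitarily equivalent. -/
theorem exists_unitary_of_inner_eq [CompleteSpace H] [CompleteSpace H']
    (V : ∀ i, F i →ₗ[k] H) (V' : ∀ i, F i →ₗ[k] H')
    (hV : Dense (Submodule.span k (⋃ i, Set.range (V i)) : Set H))
    (hV' : Dense (Submodule.span k (⋃ i, Set.range (V' i)) : Set H'))
    (h : ∀ i j a b, ⟪V i a, V j b⟫_k = ⟪V' i a, V' j b⟫_k) :
    ∃ U : H ≃ₗᵢ[k] H', ∀ i a, U (V i a) = V' i a := by
  classical
  have hnorm : ∀ f, ‖famSum V' f‖ = ‖famSum V f‖ := fun f => by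
    rw [← sq_eq_sq₀ (norm_nonneg _) (norm_nonneg _), ← inner_self_eq_norm_sq (𝕜 := k),
      ← inner_self_eq_norm_sq (𝕜 := k)]
    simp only [famSum_eq_sum, sum_inner, inner_sum, h]
  rw [← range_famSum] at hV hV'
  refine ⟨(LinearEquiv.refl k (Π₀ i, F i)).extendOfIsometry (famSum V) (famSum V')
    hV hV' hnorm, fun i a => ?_⟩
  rw [← famSum_single V i a, ← famSum_single V' i a]
  exact LinearEquiv.extendOfIsometry_eq (LinearEquiv.refl k _) _ _ hV hV' hnorm _

variable {J : Type uI} {F' : J → Type uF}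
  [∀ j, NormedAddCommGroup (F' j)] [∀ j, InnerProductSpace k (F' j)]

/-- A family of maps `W` having a formal adjoint `W'` induces a linear map between the spans. -/
theorem exists_span_map (V : ∀ i, F i →ₗ[k] H) (V' : ∀ j, F' j →ₗ[k] H')
    {N : Submodule k H} (hN : N = Submodule.span k (⋃ i, Set.range (V i)))
    {N' : Submodule k H'} (hN' : N' = Submodule.span k (⋃ j, Set.range (V' j)))
    (W : ∀ i, F i →ₗ[k] H') (W' : ∀ j, F' j → H)
    (hW : ∀ i a, W i a ∈ N')
    (hadj : ∀ i j a b, ⟪W i a, V' j b⟫_k = ⟪V i a, W' j b⟫_k) :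
    ∃ T : N →ₗ[k] N', ∀ i a (m : V i a ∈ N), T ⟨V i a, m⟩ = ⟨W i a, hW i a⟩ := by
  classical
  subst hN hN'
  have hmem : ∀ f, famSum W f ∈ Submodule.span k (⋃ j, Set.range (V' j)) := fun f => by
    rw [famSum_eq_sum]
    exact Submodule.sum_mem _ fun i _ => hW i _
  have hker : LinearMap.ker (famSum V) ≤ LinearMap.ker (famSum W) := fun f hf => by
    rw [LinearMap.mem_ker] at hf ⊢
    have horth : ∀ y ∈ Submodule.span k (⋃ j, Set.range (V' j)),
        ⟪famSum W f, y⟫_k = 0 := fun y hy => by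
      induction hy using Submodule.span_induction with
      | mem y hy =>
        obtain ⟨j, b, rfl⟩ := Set.mem_iUnion.1 hy
        simp only [inner_famSum_left, hadj]
        rw [← inner_famSum_left, hf, inner_zero_left]
      | zero => simp
      | add y z _ _ hy hz => rw [inner_add_right, hy, hz, add_zero]
      | smul r y _ hy => rw [inner_smul_right, hy, mul_zero]
    exact inner_self_eq_zero.1 (horth _ (hmem f))
  obtain ⟨σ, hσ⟩ := (famSum V).rangeRestrict.exists_rightInverse_of_surjective
    (LinearMap.range_rangeRestrict _)
  refine ⟨(famSum W).codRestrict _ hmem ∘ₗ σ ∘ₗ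
    (LinearEquiv.ofEq _ _ (range_famSum V).symm).toLinearMap, fun i a m => Subtype.ext ?_⟩
  have hs := LinearMap.congr_fun hσ (LinearEquiv.ofEq _ _ (range_famSum V).symm ⟨V i a, m⟩)
  have hs' := congrArg Subtype.val hs
  simp only [LinearMap.comp_apply, LinearMap.codRestrict_apply, LinearMap.id_apply,
    LinearMap.rangeRestrict, LinearEquiv.coe_ofEq_apply, LinearEquiv.coe_coe] at hs' ⊢
  have := hker (LinearMap.mem_ker.2 <| (map_sub (famSum V) _ (single i a)).trans <|
    sub_eq_zero.2 (hs'.trans (famSum_single V i a).symm))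
  rwa [LinearMap.mem_ker, map_sub, sub_eq_zero, famSum_single] at this

theorem span_iUnion_range_induction (V : ∀ i, F i →ₗ[k] H) {N : Submodule k H}
    (hN : N = Submodule.span k (⋃ i, Set.range (V i))) {P : N → Prop}
    (gen : ∀ i a (m : V i a ∈ N), P ⟨V i a, m⟩) (zero : P 0)
    (add : ∀ f g, P f → P g → P (f + g)) (smul : ∀ (r : k) f, P f → P (r • f)) (f : N) :
    P f := by
  subst hN
  obtain ⟨f, hf⟩ := f
  induction hf using Submodule.span_induction with
  | mem y hy =>
    obtain ⟨i, a, rfl⟩ := Set.mem_iUnion.1 hy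
    exact gen i a _
  | zero => exact zero
  | add y z hy hz ihy ihz => exact add ⟨y, hy⟩ ⟨z, hz⟩ ihy ihz
  | smul r y hy ih => exact smul r ⟨y, hy⟩ ih

end Kolmogorov

set_option linter.unusedSectionVars false

section Transport

theorem castE_symm {o o' : O} (h : o = o') : (castE 𝕜 E h).symm = castE 𝕜 E h.symm := by
  subst h; rfl

theorem castE_castE {o o' o'' : O} (h : o = o') (h' : o' = o'') (k : E o) :
    castE 𝕜 E h' (castE 𝕜 E h k) = castE 𝕜 E (h.trans h') k := by
  subst h h'; rfl

theorem kernel_castE_congr (K : ∀ y x : X, E (p x) →L[𝕜] E (p y)) {x x' y : X} (e : x = x')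
    {o : O} (h : o = p x) (h' : o = p x') (k : E o) :
    K y x (castE 𝕜 E h k) = K y x' (castE 𝕜 E h' k) := by
  subst e; rfl

theorem coe_castSub {𝒦 : S → HSp.{u, w'} 𝕜} (D : ∀ s : S, Submodule 𝕜 (𝒦 s).carrier) {s t : S}
    (h : s = t) (f : D s) : (castSub D h f : (𝒦 t).carrier) = castH 𝕜 𝒦 h f := by
  subst h; rfl

variable {𝒦 : S → HSp.{u, w'} 𝕜}
  (V : ∀ (s : S) (x : {x : X // A.a x = s}), E (p x.1) →L[𝕜] (𝒦 s).carrier)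

theorem castH_fibre {s t : S} (h : s = t) (x : {x : X // A.a x = s}) (k : E (p x.1)) :
    castH 𝕜 𝒦 h (V s x k) = V t ⟨x.1, x.2.trans h⟩ k := by
  subst h; rfl

theorem fibre_castE_congr {s : S} {x x' : X} (e : x = x') (hx : A.a x = s) (hx' : A.a x' = s)
    {o : O} (h : o = p x) (h' : o = p x') (k : E o) :
    V s ⟨x, hx⟩ (castE 𝕜 E h k) = V s ⟨x', hx'⟩ (castE 𝕜 E h' k) := by
  subst e; rfl

end Transport

/-- Shifting by `α` and by `α*` are formally adjoint for a `Γ`-invariant kernel. -/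
theorem GammaInvariant.inner_shift {K : ∀ y x : X, E (p x) →L[𝕜] E (p y)}
    (hKinv : GammaInvariant A p hp K) (α : Γ) {x y : X} (hx : G.d α = A.a x)
    (hy : G.c α = A.a y) (k : E (p x)) (l : E (p y)) :
    ⟪K y (A.act α x) (castE 𝕜 E (hp hx).symm k), l⟫_𝕜 =
      ⟪K (A.act (G.star α) y) x k,
        castE 𝕜 E (hp ((G.d_star α).trans hy)).symm l⟫_𝕜 := by
  have h := hKinv (G.star α) y x ((G.d_star α).trans hy) ((G.c_star α).trans hx) k
  rw [castE_symm] at h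
  rw [kernel_castE_congr p K (congrArg (A.act · x) (G.star_star α).symm) _
    (hp ((G.d_star (G.star α)).trans ((G.c_star α).trans hx))).symm, ← h,
    LinearIsometryEquiv.inner_map_eq_flip, castE_symm]

namespace GenInvLin

variable {A p}
variable {K : ∀ y x : X, E (p x) →L[𝕜] E (p y)}

/-- The operators `V_x`, `x ∈ X_s`, of a linearisation as maps into the fibre over `s`. -/
def fibre (L : GenInvLin.{u, uΓ, uS, v, vO, w, w'} 𝕜 E A p hp K) (s : S)
    (x : {x : X // A.a x = s}) : E (p x.1) →ₗ[𝕜] (L.Ksp s).carrier :=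
  (castH 𝕜 L.Ksp x.2).toLinearEquiv.toLinearMap ∘ₗ (L.V x.1).toLinearMap

variable {hp}

theorem inner_fibre (L : GenInvLin.{u, uΓ, uS, v, vO, w, w'} 𝕜 E A p hp K) (s : S)
    (y x : {x : X // A.a x = s}) (k : E (p y.1)) (h : E (p x.1)) :
    ⟪L.fibre hp s y k, L.fibre hp s x h⟫_𝕜 = ⟪K x.1 y.1 k, h⟫_𝕜 := by
  obtain ⟨x, rfl⟩ := x
  exact (L.lin x y.1 y.2 k h).symm

theorem fibre_mem (L : GenInvLin.{u, uΓ, uS, v, vO, w, w'} 𝕜 E A p hp K) (s : S)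
    (x : {x : X // A.a x = s}) (h : E (p x.1)) : L.fibre hp s x h ∈ L.D s := by
  obtain ⟨x, rfl⟩ := x
  exact L.mem_D x h

theorem Ψ_fibre (L : GenInvLin.{u, uΓ, uS, v, vO, w, w'} 𝕜 E A p hp K) (α : Γ)
    (x : {x : X // A.a x = G.d α}) (h : E (p x.1)) (m : L.fibre hp (G.d α) x h ∈ L.D (G.d α)) :
    (L.Ψ α ⟨L.fibre hp (G.d α) x h, m⟩ : (L.Ksp (G.c α)).carrier) =
      L.fibre hp (G.c α) ⟨A.act α x.1, A.a_act x.2.symm⟩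
        ((castE 𝕜 E (hp x.2.symm)).symm h) := by
  refine Eq.trans ?_ (L.Ψ_shift α x.1 x.2.symm h)
  congr 2
  exact Subtype.ext (coe_castSub L.D x.2 ⟨L.V x.1 h, L.mem_D x.1 h⟩).symm

/-- Minimal linearisations whose domains are the spans of the ranges of the operators `V_x`
are unitarily equivalent. -/
theorem exists_unitary (L : GenInvLin.{u, uΓ, uS, v, vO, w, w'} 𝕜 E A p hp K)
    (L' : GenInvLin.{u, uΓ, uS, v, vO, w, w'} 𝕜 E A p hp K) (hL : L.Minimal) (hL' : L'.Minimal)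
    (hD : ∀ s, L.D s = Submodule.span 𝕜 (⋃ x, Set.range (L.fibre hp s x))) :
    ∃ U : ∀ s : S, (L.Ksp s).carrier ≃ₗᵢ[𝕜] (L'.Ksp s).carrier,
      (∀ s : S, (U s) '' (L.D s) ⊆ L'.D s) ∧
      (∀ (α : Γ) (f : ↥(L.D (G.d α))) (g : ↥(L'.D (G.d α))),
        U (G.d α) ↑f = ↑g → U (G.c α) ↑(L.Ψ α f) = ↑(L'.Ψ α g)) ∧
      (∀ (x : X) (h : E (p x)), U (A.a x) (L.V x h) = L'.V x h) := by
  choose U hU using fun s => exists_unitary_of_inner_eq (L.fibre hp s) (L'.fibre hp s)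
    (hL s) (hL' s) fun x y k h => (L.inner_fibre s x y k h).trans (L'.inner_fibre s x y k h).symm
  have hUD : ∀ s (f : L.D s), U s f ∈ L'.D s := fun s f => by
    induction f using span_iUnion_range_induction (L.fibre hp s) (hD s) with
    | gen x h m => rw [hU]; exact L'.fibre_mem s x h
    | zero => simp
    | add f g hf hg => simpa using add_mem hf hg
    | smul r f hf => simpa using (L'.D s).smul_mem r hf
  refine ⟨U, fun s => ?_, fun α f g hfg => ?_, fun x h => hU (A.a x) ⟨x, rfl⟩ h⟩
  · rintro _ ⟨f, hf, rfl⟩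
    exact hUD s ⟨f, hf⟩
  · obtain rfl : (⟨_, hUD _ f⟩ : L'.D (G.d α)) = g := Subtype.ext hfg
    clear hfg
    let T : L.D (G.d α) →ₗ[𝕜] L'.D (G.d α) :=
      ((U (G.d α)).toLinearEquiv.toLinearMap ∘ₗ (L.D (G.d α)).subtype).codRestrict _ (hUD _)
    change U (G.c α) (L.Ψ α f) = L'.Ψ α (T f)
    induction f using span_iUnion_range_induction (L.fibre hp (G.d α)) (hD (G.d α)) with
    | gen x h m =>
      have hT : T ⟨_, m⟩ = ⟨_, L'.fibre_mem (G.d α) x h⟩ := Subtype.ext (hU (G.d α) x h)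
      rw [hT, Ψ_fibre, Ψ_fibre, hU]
    | zero => simp
    | add f g hf hg => simp [hf, hg]
    | smul r f hf => simp [hf]

/-- Existence of a minimal linearisation whose domains are the spans of the ranges of the
operators `V_x`. -/
theorem exists_minimal (hK : PartPSD A p K) (hKinv : GammaInvariant A p hp K) :
    ∃ L : GenInvLin.{u, uΓ, uS, v, vO, w, max v w} 𝕜 E A p hp K, L.Minimal ∧
      ∀ s, L.D s = Submodule.span 𝕜 (⋃ x, Set.range (L.fibre hp s x)) := by
  choose 𝒦 V hinner hdense using fun s : S =>
    exists_kolmogorov (k := 𝕜) (I := {x : X // A.a x = s}) (F := fun x => E (p x.1))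
      (fun x y => K x.1 y.1)
      (fun x y k h => by
        rw [← hK.1 x.1 y.1 (x.2.trans y.2.symm), ContinuousLinearMap.adjoint_inner_left])
      (fun n x h => hK.2 s n (fun i => (x i).1) (fun i => (x i).2) h)
  obtain ⟨D, hD⟩ : ∃ D : ∀ s, Submodule 𝕜 (𝒦 s).carrier,
      ∀ s, D s = Submodule.span 𝕜 (⋃ x, Set.range (V s x).toLinearMap) := ⟨_, fun _ => rfl⟩
  have hVD : ∀ s x k, V s x k ∈ D s := fun s x k => by
    rw [hD]
    exact Submodule.subset_span (Set.mem_iUnion.2 ⟨x, k, rfl⟩)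
  have ind : ∀ s {P : D s → Prop}, (∀ x k, P ⟨V s x k, hVD s x k⟩) → P 0 →
      (∀ f g, P f → P g → P (f + g)) → (∀ (r : 𝕜) f, P f → P (r • f)) → ∀ f, P f :=
    fun s _ gen => span_iUnion_range_induction (fun x => (V s x).toLinearMap) (hD s)
      fun x k _ => gen x k
  have hadj : ∀ (α : Γ) (x : {x : X // A.a x = G.d α}) (y : {y : X // A.a y = G.c α})
      (k : E (p x.1)) (l : E (p y.1)),
      ⟪V (G.c α) ⟨A.act α x.1, A.a_act x.2.symm⟩ (castE 𝕜 E (hp x.2.symm).symm k),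
        V (G.c α) y l⟫_𝕜 =
      ⟪V (G.d α) x k, V (G.d α) ⟨A.act (G.star α) y.1,
          (A.a_act ((G.d_star α).trans y.2.symm)).trans (G.c_star α)⟩
        (castE 𝕜 E (hp ((G.d_star α).trans y.2.symm)).symm l)⟫_𝕜 := fun α x y k l => by
    rw [hinner, hinner]
    exact hKinv.inner_shift A p hp α x.2.symm y.2.symm k l
  have hex : ∀ α : Γ, ∃ T : D (G.d α) →ₗ[𝕜] D (G.c α), ∀ x k, T ⟨V (G.d α) x k, hVD _ x k⟩ =
      ⟨V (G.c α) ⟨A.act α x.1, A.a_act x.2.symm⟩ (castE 𝕜 E (hp x.2.symm).symm k),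
        hVD _ _ _⟩ := fun α => by
    obtain ⟨T, hT⟩ := exists_span_map (fun x => (V (G.d α) x).toLinearMap)
      (fun x => (V (G.c α) x).toLinearMap) (hD _) (hD _)
      (fun x => (V (G.c α) ⟨A.act α x.1, A.a_act x.2.symm⟩).toLinearMap ∘ₗ
        (castE 𝕜 E (hp x.2.symm).symm).toLinearEquiv.toLinearMap) _
      (fun x k => hVD _ _ _) (hadj α)
    exact ⟨T, fun x k => hT x k _⟩
  choose Ψ hΨ using hex
  have hcast : ∀ {s t : S} (e : s = t) x k, castSub D e ⟨V s x k, hVD s x k⟩ =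
      ⟨V t ⟨x.1, x.2.trans e⟩ k, hVD _ _ _⟩ := fun e x k =>
    Subtype.ext ((coe_castSub D e _).trans (castH_fibre A p V e x k))
  have hrange : ∀ s, (⋃ x : {x : X // A.a x = s}, Set.range fun h : E (p x.1) =>
      castH 𝕜 𝒦 x.2 (V (A.a x.1) ⟨x.1, rfl⟩ h)) = ⋃ x, Set.range (V s x) := fun s => by
    simp only [castH_fibre]
  refine ⟨{
    Ksp := 𝒦
    D := D
    dense_D := fun s => by rw [hD]; exact hdense s
    V := fun x => V (A.a x) ⟨x, rfl⟩
    mem_D := fun x k => hVD (A.a x) ⟨x, rfl⟩ k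
    lin := fun x y hxy k h => by rw [castH_fibre, hinner]
    Ψ := Ψ
    Ψ_mul := fun α β hc => ?_
    Ψ_adj := fun α f g => ?_
    Ψ_shift := fun α x hx h => by rw [hcast, hΨ, castH_fibre, castE_symm] },
    fun s => (congrArg (fun R => Dense (Submodule.span 𝕜 R : Set (𝒦 s).carrier))
      (hrange s)).mpr (hdense s),
    fun s => (hD s).trans (congrArg (Submodule.span 𝕜) (hrange s).symm)⟩
  · refine ind _ (fun x k => ?_) ?_ (fun f₁ f₂ h₁ h₂ => ?_) (fun r f₁ h₁ => ?_)
    · simp only [hcast, hΨ, castE_castE]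
      exact Subtype.ext (fibre_castE_congr A p V (A.act_mul x.2.symm hc) _ _ _ _ k)
    · simp
    · simp only [map_add, h₁, h₂]
    · simp only [map_smul, h₁]
  · revert f
    refine ind _ (fun x k => ?_) ?_ (fun f₁ f₂ h₁ h₂ => ?_) (fun r f₁ h₁ => ?_)
    · revert g
      refine ind _ (fun y l => ?_) ?_ (fun g₁ g₂ h₁ h₂ => ?_) (fun r g₁ h₁ => ?_)
      · simp only [hcast, hΨ]
        exact hadj α x y k l
      · simp
      · simp only [map_add, Submodule.coe_add, inner_add_right, h₁, h₂]
      · simp only [map_smul, Submodule.coe_smul, inner_smul_right, h₁]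
    · simp
    · simp only [map_add, Submodule.coe_add, inner_add_left, h₁, h₂]
    · simp only [map_smul, Submodule.coe_smul, inner_smul_left, h₁]

end GenInvLin

/-- a `Γ`-invariant, partially positive semidefinite kernel has a
minimal generalised `Γ`-invariant Hilbert space linearisation, unique modulo
unitary equivalence among those whose domains `D′_s` are the linear spans of
the ranges of the `V′_x`. -/
theorem gen_inv_linearisation_exists_unique
    (K : ∀ y x : X, E (p x) →L[𝕜] E (p y))
    (hK : PartPSD A p K) (hKinv : GammaInvariant A p hp K) :
    ∃ L : GenInvLin.{u, uΓ, uS, v, vO, w, max v w} 𝕜 E A p hp K,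
      GenInvLin.Minimal L ∧
      ∀ L' : GenInvLin.{u, uΓ, uS, v, vO, w, max v w} 𝕜 E A p hp K,
        GenInvLin.Minimal L' →
        (∀ s : S, L'.D s = Submodule.span 𝕜 (⋃ x : {x : X // A.a x = s},
          Set.range fun h : E (p x.val) => castH 𝕜 L'.Ksp x.2 (L'.V x.val h))) →
        ∃ U : ∀ s : S, (L.Ksp s).carrier ≃ₗᵢ[𝕜] (L'.Ksp s).carrier,
          (∀ s : S, (U s) '' (L.D s) ⊆ L'.D s) ∧
          (∀ (α : Γ) (f : ↥(L.D (G.d α))) (g : ↥(L'.D (G.d α))),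
            U (G.d α) ↑f = ↑g →
            U (G.c α) ↑(L.Ψ α f) = ↑(L'.Ψ α g)) ∧
          (∀ (x : X) (h : E (p x)), U (A.a x) (L.V x h) = L'.V x h) := by
  obtain ⟨L, hL, hD⟩ := GenInvLin.exists_minimal hK hKinv
  exact ⟨L, hL, fun L' hL' _ => L.exists_unitary L' hL hL' hD⟩
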